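/- Let α, β ∈ ℝ, let ε ∈ (0,1) and γ > 0, and assume that for every (n₁, n₂) ∈ ℤ² with (n₁, n₂) ≠ (0,0), ‖n₁α + n₂β‖ > γ·(1+|n₁|)^{-1-ε}·(1+|n₂|)^{-1-ε}. Then there is a constant c, depending only on γ and ε, such that for every real R ≥ 2, Σ_{n=(n₁,n₂)∈ℤ², 0<|n|<R} (1+|n₁|)^{-1}·(1+|n₂|)^{-1}·(1/‖n₁α + n₂β‖) ≤ c · R^{2ε} · log R. -/

import Mathlib

open Real

/-- The distance from a real number to the nearest integer, `‖u‖ = |u − round u|`. -/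
noncomputable def distToInt (u : ℝ) : ℝ := |u - round u|

lemma distToInt_le_abs_sub_intCast (u : ℝ) (m : ℤ) : distToInt u ≤ |u - m| := round_le u m

lemma distToInt_le_one (u : ℝ) : distToInt u ≤ 1 :=
  (abs_sub_round u).trans (by norm_num)

/-- The reciprocals of `δ`-separated points of `[δ, 1]` have sum at most `δ⁻¹ (1 + log δ⁻¹)`. -/
lemma sum_inv_le_of_separated {ι : Type*} (S : Finset ι) (g : ι → ℝ) {δ L : ℝ} (hδ : 0 < δ)
    (hL : 0 ≤ L) (hδL : 1 + log δ⁻¹ ≤ L) (hg : ∀ i ∈ S, δ ≤ g i) (hg1 : ∀ i ∈ S, g i ≤ 1)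
    (hsep : ∀ i ∈ S, ∀ j ∈ S, i ≠ j → δ ≤ |g i - g j|) :
    ∑ i ∈ S, (g i)⁻¹ ≤ δ⁻¹ * L := by
  classical
  rcases S.eq_empty_or_nonempty with rfl | ⟨i₀, hi₀⟩
  · simpa using mul_nonneg (inv_nonneg.2 hδ.le) hL
  have hδ1 : 1 ≤ δ⁻¹ := (one_le_inv₀ hδ).2 ((hg i₀ hi₀).trans (hg1 i₀ hi₀))
  let k : ι → ℕ := fun i => ⌊g i / δ⌋₊
  have hk1 : ∀ i ∈ S, 1 ≤ k i := fun i hi =>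
    Nat.le_floor (by simpa using (one_le_div hδ).2 (hg i hi))
  have hkle : ∀ i ∈ S, (k i : ℝ) ≤ g i / δ := fun i hi =>
    Nat.floor_le (div_nonneg (hδ.le.trans (hg i hi)) hδ.le)
  have hinj : Set.InjOn k S := by
    intro i hi j hj hij
    by_contra hne
    have h1 := hkle i hi
    have h2 := hkle j hj
    have h3 : g i / δ < k i + 1 := Nat.lt_floor_add_one _
    have h4 : g j / δ < k j + 1 := Nat.lt_floor_add_one _
    rw [hij] at h1 h3
    have h5 : |g i / δ - g j / δ| < 1 := abs_lt.2 ⟨by linarith, by linarith⟩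
    rw [← sub_div, abs_div, abs_of_pos hδ, div_lt_one hδ] at h5
    exact absurd (hsep i hi j hj hne) (not_le.2 h5)
  have hmem : S.image k ⊆ Finset.Icc 1 ⌊δ⁻¹⌋₊ := by
    intro m hm
    obtain ⟨i, hi, rfl⟩ := Finset.mem_image.1 hm
    refine Finset.mem_Icc.2 ⟨hk1 i hi, Nat.floor_mono ?_⟩
    rw [div_eq_mul_inv]
    exact mul_le_of_le_one_left (inv_nonneg.2 hδ.le) (hg1 i hi)
  calc ∑ i ∈ S, (g i)⁻¹ ≤ ∑ i ∈ S, δ⁻¹ * (k i : ℝ)⁻¹ := by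
        refine Finset.sum_le_sum fun i hi => ?_
        have hkpos : (0 : ℝ) < k i := by exact_mod_cast hk1 i hi
        rw [← mul_inv]
        refine inv_anti₀ (mul_pos hδ hkpos) ?_
        have := (le_div_iff₀ hδ).1 (hkle i hi)
        linarith
    _ = δ⁻¹ * ∑ m ∈ S.image k, (m : ℝ)⁻¹ := by
        rw [Finset.sum_image hinj, Finset.mul_sum]
    _ ≤ δ⁻¹ * ∑ m ∈ Finset.Icc 1 ⌊δ⁻¹⌋₊, (m : ℝ)⁻¹ := by
        gcongr
    _ ≤ δ⁻¹ * L := by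
        have h := harmonic_floor_le_one_add_log δ⁻¹ hδ1
        rw [harmonic_eq_sum_Icc] at h
        push_cast at h
        gcongr
        exact h.trans hδL

/-- If the points `f i` are `δ`-separated modulo `1` from each other and from `0`, then
`∑ ‖f i‖⁻¹ ≤ 2 δ⁻¹ (1 + log δ⁻¹)`. -/
lemma sum_inv_distToInt_le {ι : Type*} (S : Finset ι) (f : ι → ℝ) {δ L : ℝ} (hδ : 0 < δ)
    (hL : 0 ≤ L) (hδL : 1 + log δ⁻¹ ≤ L) (hf : ∀ i ∈ S, δ ≤ distToInt (f i))
    (hsep : ∀ i ∈ S, ∀ j ∈ S, i ≠ j → δ ≤ distToInt (f i - f j)) :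
    ∑ i ∈ S, (distToInt (f i))⁻¹ ≤ 2 * (δ⁻¹ * L) := by
  classical
  let g : ι → ℝ := fun i => f i - round (f i)
  have hfg : ∀ i, distToInt (f i) = |g i| := fun i => rfl
  have hg : ∀ i ∈ S, ∀ j ∈ S, i ≠ j → δ ≤ |g i - g j| := by
    intro i hi j hj hij
    refine (hsep i hi j hj hij).trans ?_
    have hgg : g i - g j = f i - f j - ((round (f i) - round (f j) : ℤ) : ℝ) := by
      simp only [g]
      push_cast
      ring
    rw [hgg]
    exact distToInt_le_abs_sub_intCast _ _
  rw [← Finset.sum_filter_add_sum_filter_not S (fun i => 0 ≤ g i), two_mul]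
  refine add_le_add ?_ ?_ <;>
    refine sum_inv_le_of_separated _ (fun i => distToInt (f i)) hδ hL hδL
      (fun i hi => hf i (Finset.mem_filter.1 hi).1) (fun i _ => distToInt_le_one _) ?_ <;>
    intro i hi j hj hij <;>
    obtain ⟨hiS, hi0⟩ := Finset.mem_filter.1 hi <;>
    obtain ⟨hjS, hj0⟩ := Finset.mem_filter.1 hj <;>
    simp only [hfg]
  · rw [abs_of_nonneg hi0, abs_of_nonneg hj0]
    exact hg i hiS j hjS hij
  · rw [abs_of_neg (not_le.1 hi0), abs_of_neg (not_le.1 hj0), neg_sub_neg]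
    exact hg j hjS i hiS hij.symm

/-- The dyadic scale of an integer: `2 ^ dyadicScale m ≤ 1 + |m| < 2 ^ (dyadicScale m + 1)`. -/
def dyadicScale (m : ℤ) : ℕ := Nat.log 2 (1 + m.natAbs)

lemma two_pow_dyadicScale_le (m : ℤ) : (2 : ℝ) ^ dyadicScale m ≤ 1 + |(m : ℝ)| := by
  have h : 2 ^ dyadicScale m ≤ 1 + m.natAbs := Nat.pow_log_le_self 2 (by omega)
  have h' : ((2 ^ dyadicScale m : ℕ) : ℝ) ≤ ((1 + m.natAbs : ℕ) : ℝ) := Nat.cast_le.2 h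
  simpa [Nat.cast_natAbs] using h'

lemma one_add_abs_lt_two_pow (m : ℤ) : 1 + |(m : ℝ)| < 2 ^ (dyadicScale m + 1) := by
  have h : 1 + m.natAbs < 2 ^ (dyadicScale m + 1) := Nat.lt_pow_succ_log_self one_lt_two _
  have h' : ((1 + m.natAbs : ℕ) : ℝ) < ((2 ^ (dyadicScale m + 1) : ℕ) : ℝ) := Nat.cast_lt.2 h
  simpa [Nat.cast_natAbs] using h'

/-- The estimate for the points of a lattice box of dyadic size `2 ^ a × 2 ^ b`. -/
lemma sum_dyadic_box_le {ε γ α β : ℝ} (hε : 0 < ε) (hε1 : ε < 1) (hγ : 0 < γ)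
    (h : ∀ n : ℤ × ℤ, n ≠ 0 →
      γ * (1 + |(n.1 : ℝ)|) ^ (-(1 + ε)) * (1 + |(n.2 : ℝ)|) ^ (-(1 + ε))
        < distToInt ((n.1 : ℝ) * α + (n.2 : ℝ) * β))
    {R : ℝ} (hR : 2 ≤ R) {a b : ℕ} (ha : (2 : ℝ) ^ a ≤ 2 * R) (hb : (2 : ℝ) ^ b ≤ 2 * R)
    (S : Finset (ℤ × ℤ))
    (hS : ∀ n ∈ S, n ≠ 0 ∧ dyadicScale n.1 = a ∧ dyadicScale n.2 = b) :
    ∑ n ∈ S, (1 + |(n.1 : ℝ)|)⁻¹ * (1 + |(n.2 : ℝ)|)⁻¹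
        * (distToInt ((n.1 : ℝ) * α + (n.2 : ℝ) * β))⁻¹
      ≤ 512 * γ⁻¹ * ((18 + 2 * |log γ|) * log R) * (((2 : ℝ) ^ ε) ^ a * ((2 : ℝ) ^ ε) ^ b) := by
  set A : ℝ := 2 ^ a with hA
  set B : ℝ := 2 ^ b with hB
  have hA0 : 0 < A := by positivity
  have hB0 : 0 < B := by positivity
  set δ : ℝ := γ * (4 * A) ^ (-(1 + ε)) * (4 * B) ^ (-(1 + ε)) with hδdef
  have hδ : 0 < δ := by positivity
  have hlow : ∀ m : ℤ × ℤ, m ≠ 0 → 1 + |(m.1 : ℝ)| ≤ 4 * A → 1 + |(m.2 : ℝ)| ≤ 4 * B →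
      δ ≤ distToInt ((m.1 : ℝ) * α + (m.2 : ℝ) * β) := by
    intro m hm h1 h2
    refine le_trans ?_ (h m hm).le
    have e1 : (4 * A) ^ (-(1 + ε)) ≤ (1 + |(m.1 : ℝ)|) ^ (-(1 + ε)) :=
      rpow_le_rpow_of_nonpos (by positivity) h1 (by linarith)
    have e2 : (4 * B) ^ (-(1 + ε)) ≤ (1 + |(m.2 : ℝ)|) ^ (-(1 + ε)) :=
      rpow_le_rpow_of_nonpos (by positivity) h2 (by linarith)
    rw [hδdef]
    gcongr
  have hlogR : 1 / 2 ≤ log R := by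
    have := log_le_log (by norm_num) hR
    linarith [log_two_gt_d9]
  have hlog4 : ∀ x : ℝ, 0 < x → x ≤ 2 * R → log (4 * x) ≤ 4 * log R := by
    intro x hx hxR
    have e : (4 : ℝ) * log R = log (R ^ 4) := by rw [log_pow]; norm_num
    rw [e]
    refine log_le_log (by positivity) ?_
    have : (8 : ℝ) ≤ R ^ 3 := by
      calc (8 : ℝ) = 2 ^ 3 := by norm_num
        _ ≤ R ^ 3 := by gcongr
    nlinarith
  have hlogpos : ∀ (x : ℝ) (k : ℕ), x = 2 ^ k → 0 ≤ log (4 * x) := by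
    intro x k hx
    refine log_nonneg ?_
    have : (1 : ℝ) ≤ x := by rw [hx]; exact one_le_pow₀ (by norm_num)
    linarith
  have hinv : δ⁻¹ = γ⁻¹ * (4 * A) ^ (1 + ε) * (4 * B) ^ (1 + ε) := by
    rw [hδdef, mul_inv, mul_inv, rpow_neg (by positivity), rpow_neg (by positivity), inv_inv,
      inv_inv]
  have hδL : 1 + log δ⁻¹ ≤ (18 + 2 * |log γ|) * log R := by
    rw [hinv, log_mul (by positivity) (by positivity), log_mul (by positivity) (by positivity),
      log_rpow (by positivity), log_rpow (by positivity), log_inv]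
    have h1 := hlog4 A hA0 ha
    have h2 := hlog4 B hB0 hb
    have h3 := hlogpos A a hA
    have h4 := hlogpos B b hB
    have h5 := neg_le_abs (log γ)
    have h6 : |log γ| ≤ 2 * |log γ| * log R := by nlinarith [abs_nonneg (log γ)]
    nlinarith
  have hL : 0 ≤ (18 + 2 * |log γ|) * log R := by positivity
  have hbox : ∀ n ∈ S, 1 + |(n.1 : ℝ)| < 2 * A ∧ 1 + |(n.2 : ℝ)| < 2 * B := by
    intro n hn
    obtain ⟨-, h1, h2⟩ := hS n hn
    have e1 := one_add_abs_lt_two_pow n.1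
    have e2 := one_add_abs_lt_two_pow n.2
    rw [h1, pow_succ] at e1
    rw [h2, pow_succ] at e2
    constructor <;> linarith
  have hsum := sum_inv_distToInt_le S (fun n => (n.1 : ℝ) * α + (n.2 : ℝ) * β) hδ hL hδL
    (fun n hn => hlow n (hS n hn).1 (by linarith [(hbox n hn).1]) (by linarith [(hbox n hn).2]))
    (by
      intro i hi j hj hij
      have h1 := hbox i hi
      have h2 := hbox j hj
      have e1 := abs_sub (i.1 : ℝ) (j.1 : ℝ)
      have e2 := abs_sub (i.2 : ℝ) (j.2 : ℝ)
      have := hlow (i - j) (sub_ne_zero.2 hij)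
        (by rw [Prod.fst_sub]; push_cast; linarith) (by rw [Prod.snd_sub]; push_cast; linarith)
      convert this using 2
      rw [Prod.fst_sub, Prod.snd_sub]
      push_cast
      ring)
  have hpow : ∀ x : ℝ, 0 < x → x⁻¹ * (4 * x) ^ (1 + ε) ≤ 16 * x ^ ε := by
    intro x hx
    have e4 : (4 : ℝ) ^ (1 + ε) ≤ 16 := by
      calc (4 : ℝ) ^ (1 + ε) ≤ 4 ^ (2 : ℝ) :=
            rpow_le_rpow_of_exponent_le (by norm_num) (by linarith)
        _ = 16 := by norm_num
    rw [mul_rpow (by norm_num) hx.le, rpow_add hx, rpow_one]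
    calc x⁻¹ * (4 ^ (1 + ε) * (x * x ^ ε)) = 4 ^ (1 + ε) * x ^ ε := by field_simp
      _ ≤ 16 * x ^ ε := by gcongr
  have hcomm : ∀ k : ℕ, ((2 : ℝ) ^ k) ^ ε = ((2 : ℝ) ^ ε) ^ k := fun k =>
    (rpow_pow_comm (by norm_num) ε k).symm
  calc _ ≤ ∑ n ∈ S, A⁻¹ * B⁻¹ * (distToInt ((n.1 : ℝ) * α + (n.2 : ℝ) * β))⁻¹ := by
        refine Finset.sum_le_sum fun n hn => ?_
        obtain ⟨-, h1, h2⟩ := hS n hn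
        have e1 := two_pow_dyadicScale_le n.1
        have e2 := two_pow_dyadicScale_le n.2
        rw [h1] at e1
        rw [h2] at e2
        have e3 : 0 ≤ distToInt ((n.1 : ℝ) * α + (n.2 : ℝ) * β) := abs_nonneg _
        gcongr
    _ ≤ A⁻¹ * B⁻¹ * (2 * (δ⁻¹ * ((18 + 2 * |log γ|) * log R))) := by
        rw [← Finset.mul_sum]
        gcongr
    _ = 2 * γ⁻¹ * ((18 + 2 * |log γ|) * log R) *
          ((A⁻¹ * (4 * A) ^ (1 + ε)) * (B⁻¹ * (4 * B) ^ (1 + ε))) := by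
        rw [hinv]; ring
    _ ≤ 2 * γ⁻¹ * ((18 + 2 * |log γ|) * log R) * ((16 * A ^ ε) * (16 * B ^ ε)) := by
        refine mul_le_mul_of_nonneg_left ?_ (by positivity)
        exact mul_le_mul (hpow A hA0) (hpow B hB0) (by positivity) (by positivity)
    _ = _ := by
        rw [hA, hB, hcomm, hcomm]; ring

lemma dyadicScale_mem_range {R : ℝ} (hR : 2 ≤ R) {m : ℤ} (hm : |(m : ℝ)| < R) :
    dyadicScale m ∈ Finset.range (Nat.log 2 ⌊2 * R⌋₊ + 1) := by
  have h := two_pow_dyadicScale_le m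
  have h2 : 2 ^ dyadicScale m ≤ ⌊2 * R⌋₊ := Nat.le_floor (by push_cast; linarith)
  exact Finset.mem_range.2 (Nat.lt_succ_of_le (Nat.le_log_of_pow_le one_lt_two h2))

lemma two_pow_log_floor_le {R : ℝ} (hR : 2 ≤ R) : (2 : ℝ) ^ Nat.log 2 ⌊2 * R⌋₊ ≤ 2 * R := by
  have h0 : ⌊2 * R⌋₊ ≠ 0 := (Nat.floor_pos.2 (by linarith)).ne'
  have h1 : ((2 ^ Nat.log 2 ⌊2 * R⌋₊ : ℕ) : ℝ) ≤ (⌊2 * R⌋₊ : ℝ) :=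
    Nat.cast_le.2 (Nat.pow_log_le_self 2 h0)
  push_cast at h1
  exact h1.trans (Nat.floor_le (by linarith))

lemma geom_sum_dyadic_le {ε R : ℝ} (hε : 0 < ε) (hε1 : ε < 1) (hR : 2 ≤ R) :
    ∑ a ∈ Finset.range (Nat.log 2 ⌊2 * R⌋₊ + 1), ((2 : ℝ) ^ ε) ^ a
      ≤ 4 * ((2 : ℝ) ^ ε - 1)⁻¹ * R ^ ε := by
  have hq : 1 < (2 : ℝ) ^ ε := one_lt_rpow (by norm_num) hε
  have hpow : ((2 : ℝ) ^ ε) ^ (Nat.log 2 ⌊2 * R⌋₊ + 1) ≤ 4 * R ^ ε := by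
    rw [rpow_pow_comm (by norm_num)]
    calc ((2 : ℝ) ^ (Nat.log 2 ⌊2 * R⌋₊ + 1)) ^ ε ≤ (4 * R) ^ ε := by
          refine rpow_le_rpow (by positivity) ?_ hε.le
          rw [pow_succ]
          linarith [two_pow_log_floor_le hR]
      _ = 4 ^ ε * R ^ ε := mul_rpow (by norm_num) (by linarith)
      _ ≤ 4 * R ^ ε := by
          gcongr
          exact rpow_le_self_of_one_le (by norm_num) hε1.le
  rw [geom_sum_eq hq.ne', div_eq_mul_inv]
  have : 0 < (2 : ℝ) ^ ε - 1 := by linarith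
  calc _ ≤ (4 * R ^ ε) * ((2 : ℝ) ^ ε - 1)⁻¹ := by gcongr; linarith
    _ = _ := by ring

/-- **Weighted lattice sum estimate**: if for some `ε ∈ (0,1)` and `γ > 0` one has
`‖n₁α + n₂β‖ > γ(1+|n₁|)^{-1-ε}(1+|n₂|)^{-1-ε}` for all `(n₁,n₂) ≠ (0,0)`, then there is
`c` depending only on `γ` and `ε` such that for every `R ≥ 2`,
`∑_{0<|n|<R} (1+|n₁|)⁻¹(1+|n₂|)⁻¹ ‖n₁α+n₂β‖⁻¹ ≤ c · R^{2ε} · log R`. -/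
theorem weighted_lattice_sum_estimate (ε γ : ℝ) (hε : 0 < ε) (hε1 : ε < 1)
    (hγ : 0 < γ) :
    ∃ c > 0, ∀ α β : ℝ,
      (∀ n : ℤ × ℤ, n ≠ 0 →
        γ * (1 + |(n.1 : ℝ)|) ^ (-(1 + ε)) * (1 + |(n.2 : ℝ)|) ^ (-(1 + ε))
          < distToInt ((n.1 : ℝ) * α + (n.2 : ℝ) * β)) →
      ∀ R : ℝ, 2 ≤ R →
        ∑' n : {n : ℤ × ℤ // n ≠ 0 ∧ Real.sqrt ((n.1 : ℝ) ^ 2 + (n.2 : ℝ) ^ 2) < R},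
          (1 + |(n.1.1 : ℝ)|)⁻¹ * (1 + |(n.1.2 : ℝ)|)⁻¹
            * (distToInt ((n.1.1 : ℝ) * α + (n.1.2 : ℝ) * β))⁻¹
        ≤ c * R ^ (2 * ε) * Real.log R := by
  have hq : 0 < (2 : ℝ) ^ ε - 1 := by linarith [one_lt_rpow (by norm_num : (1 : ℝ) < 2) hε]
  refine ⟨512 * γ⁻¹ * (18 + 2 * |log γ|) * (4 * ((2 : ℝ) ^ ε - 1)⁻¹) ^ 2, by positivity, ?_⟩
  intro α β h R hR
  have hR0 : 0 < R := by linarith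
  have hlogR : 0 ≤ log R := log_nonneg (by linarith)
  refine tsum_le_of_sum_le' (by positivity) fun s => ?_
  classical
  let F : ℤ × ℤ → ℝ := fun n => (1 + |(n.1 : ℝ)|)⁻¹ * (1 + |(n.2 : ℝ)|)⁻¹
    * (distToInt ((n.1 : ℝ) * α + (n.2 : ℝ) * β))⁻¹
  let T : Finset (ℤ × ℤ) := s.map (Function.Embedding.subtype _)
  have hT : ∀ n ∈ T, n ≠ 0 ∧ √((n.1 : ℝ) ^ 2 + (n.2 : ℝ) ^ 2) < R := by
    intro n hn
    obtain ⟨m, -, rfl⟩ := Finset.mem_map.1 hn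
    exact m.2
  have hsum : ∑ n ∈ s, F n.1 = ∑ n ∈ T, F n := by
    rw [Finset.sum_map]; rfl
  set I := Finset.range (Nat.log 2 ⌊2 * R⌋₊ + 1) with hI
  have hmaps : ∀ n ∈ T, (dyadicScale n.1, dyadicScale n.2) ∈ I ×ˢ I := by
    intro n hn
    have hn2 := (hT n hn).2
    exact Finset.mem_product.2
      ⟨dyadicScale_mem_range hR ((abs_le_sqrt (by nlinarith)).trans_lt hn2),
        dyadicScale_mem_range hR ((abs_le_sqrt (by nlinarith)).trans_lt hn2)⟩
  have hI2 : ∀ a ∈ I, (2 : ℝ) ^ a ≤ 2 * R := by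
    intro a ha
    refine le_trans ?_ (two_pow_log_floor_le hR)
    exact pow_le_pow_right₀ (by norm_num) (Nat.le_of_lt_succ (Finset.mem_range.1 ha))
  set K := 512 * γ⁻¹ * ((18 + 2 * |log γ|) * log R) with hK
  have hK0 : 0 ≤ K := by positivity
  calc ∑ n ∈ s, F n.1 = ∑ p ∈ I ×ˢ I,
        ∑ n ∈ T with (dyadicScale n.1, dyadicScale n.2) = p, F n := by
        rw [hsum, Finset.sum_fiberwise_of_maps_to hmaps]
    _ ≤ ∑ p ∈ I ×ˢ I, K * (((2 : ℝ) ^ ε) ^ p.1 * ((2 : ℝ) ^ ε) ^ p.2) := by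
        refine Finset.sum_le_sum fun p hp => ?_
        obtain ⟨h1, h2⟩ := Finset.mem_product.1 hp
        refine sum_dyadic_box_le hε hε1 hγ h hR (hI2 _ h1) (hI2 _ h2) _ fun n hn => ?_
        obtain ⟨hnT, rfl⟩ := Finset.mem_filter.1 hn
        exact ⟨(hT n hnT).1, rfl, rfl⟩
    _ = K * (∑ a ∈ I, ((2 : ℝ) ^ ε) ^ a) ^ 2 := by
        rw [← Finset.mul_sum, sq, Finset.sum_mul_sum, Finset.sum_product]
    _ ≤ K * (4 * ((2 : ℝ) ^ ε - 1)⁻¹ * R ^ ε) ^ 2 := by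
        gcongr
        exact geom_sum_dyadic_le hε hε1 hR
    _ = _ := by
        rw [mul_comm 2 ε, rpow_mul hR0.le, rpow_two, hK]
        ring
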